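/- (1/64)·( ζ(2, 1/8) + ζ(2, 3/8) − ζ(2, 5/8) − ζ(2, 7/8) ) = (45/32)·( ζ(4)/(√2·G) )·∏_{p ≡ 7 mod 8} ( (p² − 1)/(p² + 1) )². -/

import Mathlib

open Complex Real HurwitzZeta

/-- Catalan's constant `G = ∑_{n≥0} (-1)^n/(2n+1)^2`. -/
noncomputable def catalan' : ℝ := ∑' n : ℕ, (-1 : ℝ) ^ n / (2 * n + 1) ^ 2

open ZMod in
/-- completely multiplicative function attached to an integer valued character -/
noncomputable def chf {N : ℕ} [Fact (1 < N)] (χ : MulChar (ZMod N) ℤ) : ℕ →*₀ ℝ where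
  toFun n := (χ n : ℝ) / (n : ℝ) ^ 2
  map_zero' := by simp
  map_one' := by simp
  map_mul' m n := by
    push_cast
    rw [map_mul]
    push_cast
    rw [mul_pow, mul_div_mul_comm]

instance factFour : Fact (1 < 4) := ⟨by norm_num⟩
instance factEight : Fact (1 < 8) := ⟨by norm_num⟩

lemma chf_apply {N : ℕ} [Fact (1 < N)] (χ : MulChar (ZMod N) ℤ) (n : ℕ) :
    chf χ n = (χ n : ℝ) / (n : ℝ) ^ 2 := rfl

lemma abs_of_int_cases {z : ℤ} (h : z = 0 ∨ z = 1 ∨ z = -1) : |(z : ℝ)| ≤ 1 := by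
  rcases h with h | h | h <;> simp [h]

lemma chf_summable {N : ℕ} [Fact (1 < N)] (χ : MulChar (ZMod N) ℤ)
    (h : ∀ a, χ a = 0 ∨ χ a = 1 ∨ χ a = -1) : Summable (‖chf χ ·‖) := by
  refine Summable.of_nonneg_of_le (fun _ => norm_nonneg _) (fun n => ?_)
    (Real.summable_one_div_nat_pow.mpr (by norm_num : 1 < 2))
  rw [chf_apply, Real.norm_eq_abs, abs_div, abs_of_nonneg (by positivity : (0:ℝ) ≤ (n:ℝ) ^ 2)]
  gcongr
  exact abs_of_int_cases (h _)

/-- trivial character mod 8 -/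
def chiZero : MulChar (ZMod 8) ℤ := ZMod.χ₈ * ZMod.χ₈

lemma chiZero_nat (n : ℕ) : chiZero n = if n % 2 = 0 then 0 else 1 := by
  rw [chiZero, MulChar.mul_apply, ZMod.χ₈_nat_eq_if_mod_eight]
  split_ifs <;> simp

lemma c8' : ∀ a, ZMod.χ₈' a = 0 ∨ ZMod.χ₈' a = 1 ∨ ZMod.χ₈' a = -1 := by decide
lemma c0 : ∀ a, chiZero a = 0 ∨ chiZero a = 1 ∨ chiZero a = -1 := by decide
lemma c4 : ∀ a, ZMod.χ₄ a = 0 ∨ ZMod.χ₄ a = 1 ∨ ZMod.χ₄ a = -1 := by decide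
lemma c8 : ∀ a, ZMod.χ₈ a = 0 ∨ ZMod.χ₈ a = 1 ∨ ZMod.χ₈ a = -1 := by decide

/-- local factor of the product -/
noncomputable def tt (p : ℕ) : ℝ :=
  if p % 8 = 7 then (((p : ℝ) ^ 2 - 1) / ((p : ℝ) ^ 2 + 1)) ^ 2 else 1

lemma tt_mult : Multipliable (fun p : Nat.Primes => tt p) := by
  have : (fun p : Nat.Primes => tt p) = fun p : Nat.Primes => 1 + (tt p - 1) := by
    ext p; ring
  rw [this]
  apply multipliable_one_add_of_summable
  have hs : Summable (fun n : ℕ => 4 * (1 / (n : ℝ) ^ 2)) :=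
    (Real.summable_one_div_nat_pow.mpr (by norm_num : 1 < 2)).mul_left 4
  refine Summable.of_nonneg_of_le (fun _ => norm_nonneg _) (fun p => ?_)
    (hs.comp_injective Nat.Primes.coe_nat_injective)
  have hp : (0 : ℝ) < (p : ℕ) := by exact_mod_cast p.2.pos
  simp only [Function.comp, tt]
  split_ifs
  · have : ((((p : ℕ) : ℝ) ^ 2 - 1) / (((p : ℕ) : ℝ) ^ 2 + 1)) ^ 2 - 1
        = - (4 * ((p : ℕ) : ℝ) ^ 2 / (((p : ℕ) : ℝ) ^ 2 + 1) ^ 2) := by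
      field_simp; ring
    rw [this, norm_neg, Real.norm_of_nonneg (by positivity), mul_one_div,
      div_le_div_iff₀ (by positivity) (by positivity)]
    nlinarith [sq_nonneg ((p : ℕ) : ℝ), pow_pos hp 4]
  · simp

lemma factor_eq (p : ℕ) (hp : p.Prime) :
    (1 - chf ZMod.χ₈' p)⁻¹ * (1 - chf ZMod.χ₄ p)⁻¹ =
    (1 - chf chiZero p)⁻¹ * (1 - chf ZMod.χ₈ p)⁻¹ * tt p := by
  have h2 : (2 : ℝ) ≤ p := by exact_mod_cast hp.two_le
  have ha : ((p : ℝ) ^ 2 - 1) ≠ 0 := by nlinarith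
  have hb : ((p : ℝ) ^ 2 + 1) ≠ 0 := by nlinarith
  have hc : (p : ℝ) ≠ 0 := by linarith
  have e1 : (1 - 1 / (p : ℝ) ^ 2)⁻¹ = (p : ℝ) ^ 2 / ((p : ℝ) ^ 2 - 1) := by
    rw [one_sub_div (by positivity), inv_div]
  have e2 : (1 - -1 / (p : ℝ) ^ 2)⁻¹ = (p : ℝ) ^ 2 / ((p : ℝ) ^ 2 + 1) := by
    rw [one_sub_div (by positivity), inv_div, sub_neg_eq_add]
  simp only [chf_apply, chiZero_nat, ZMod.χ₈'_nat_eq_if_mod_eight, ZMod.χ₈_nat_eq_if_mod_eight,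
    ZMod.χ₄_nat_eq_if_mod_four, tt]
  rcases (by omega : p % 2 = 0 ∨ p % 8 = 1 ∨ p % 8 = 3 ∨ p % 8 = 5 ∨ p % 8 = 7) with
    h | h | h | h | h
  · have : p % 8 ≠ 7 := by omega
    simp [h, this]
  · have h4 : p % 4 = 1 := by omega
    have h2 : p % 2 ≠ 0 := by omega
    simp [h, h2, h4]
  · have h4 : p % 4 = 3 := by omega
    have h2 : p % 2 ≠ 0 := by omega
    simp [h, h2, h4]
  · have h4 : p % 4 = 1 := by omega
    have h2 : p % 2 ≠ 0 := by omega
    simp [h, h2, h4]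
    ring
  · have h4 : p % 4 = 3 := by omega
    have h2 : p % 2 ≠ 0 := by omega
    rw [if_neg h2, if_neg h2, if_neg h2, if_neg h2, h, h4]
    norm_num only [if_true, if_false, Int.cast_one, Int.cast_neg, or_true, or_false]
    rw [e1, e2]
    field_simp

lemma main_prod : (∑' n, chf ZMod.χ₈' n) * (∑' n, chf ZMod.χ₄ n) =
    (∑' n, chf chiZero n) * (∑' n, chf ZMod.χ₈ n) * ∏' p : Nat.Primes, tt p := by
  have h1 := (EulerProduct.eulerProduct_completely_multiplicative_hasProd
    (chf_summable _ c8')).mul (EulerProduct.eulerProduct_completely_multiplicative_hasProd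
    (chf_summable _ c4))
  have h2 := ((EulerProduct.eulerProduct_completely_multiplicative_hasProd
    (chf_summable _ c0)).mul (EulerProduct.eulerProduct_completely_multiplicative_hasProd
    (chf_summable _ c8))).mul tt_mult.hasProd
  refine h1.unique ?_
  convert h2 using 2 with p
  exact factor_eq p p.2

lemma cos_sum {x : ℝ} (hx : x ∈ Set.Icc (0 : ℝ) 1) :
    HasSum (fun n : ℕ => 1 / (n : ℝ) ^ 2 * Real.cos (2 * π * n * x))
      (π ^ 2 * (x ^ 2 - x + 1 / 6)) := by
  have := hasSum_one_div_nat_pow_mul_cos (k := 1) one_ne_zero hx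
  convert this using 1
  have hb : Polynomial.bernoulli 2 = Polynomial.X ^ 2 - Polynomial.X + Polynomial.C (1 / 6 : ℚ) := by
    simp [Polynomial.bernoulli, Finset.sum_range_succ, bernoulli_two, bernoulli_one,
      ← Polynomial.C_mul_X_pow_eq_monomial]
    ring_nf
    rw [← Polynomial.C_ofNat, mul_assoc, ← Polynomial.C_mul]
    norm_num
  rw [mul_one, hb]
  simp
  left
  ring

lemma L0_val : ∑' n, chf chiZero n = π ^ 2 / 8 := by
  have h := ((cos_sum (x := 0) (by norm_num)).sub (cos_sum (x := 1 / 2) (by norm_num))).div_const 2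
  rw [← show (π ^ 2 * ((0:ℝ) ^ 2 - 0 + 1 / 6) - π ^ 2 * ((1 / 2:ℝ) ^ 2 - 1 / 2 + 1 / 6)) / 2
    = π ^ 2 / 8 by ring, ← h.tsum_eq]
  congr 1; ext n
  rw [chf_apply, chiZero_nat, show 2 * π * n * (1 / 2) = n * π by ring, Real.cos_nat_mul_pi]
  rcases Nat.even_or_odd n with hn | hn
  · simp [Nat.even_iff.mp hn, hn.neg_one_pow]
  · simp [Nat.odd_iff.mp hn, hn.neg_one_pow]

lemma cos_per (x : ℝ) (k r : ℕ) (j : ℕ) (hx : x = j * (π / 4)) :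
    Real.cos (((8 * k + r : ℕ) : ℝ) * x) = Real.cos (r * x) := by
  subst hx
  rw [← Real.cos_add_nat_mul_two_pi (r * (j * (π / 4))) (k * j)]
  congr 1
  push_cast
  ring

lemma cos_diff (n : ℕ) : Real.cos (n * (π / 4)) - Real.cos (n * (3 * π / 4)) =
    √2 * (ZMod.χ₈ n : ℝ) := by
  have h1 := Real.cos_pi_div_four
  rw [ZMod.χ₈_nat_eq_if_mod_eight]
  have hn : n = 8 * (n / 8) + n % 8 := by omega
  have hr : n % 8 < 8 := Nat.mod_lt _ (by norm_num)
  have h2 : n % 2 = n % 8 % 2 := by omega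
  rw [h2]
  conv_lhs => rw [hn]
  rw [cos_per _ _ _ 1 (by push_cast; ring), cos_per _ _ _ 3 (by push_cast; ring)]
  generalize n % 8 = r at hr
  have a1 : Real.cos (3 * π / 4) = - (√2 / 2) := by
    rw [show 3 * π / 4 = π - π / 4 by ring, Real.cos_pi_sub, h1]
  interval_cases r
  · simp
  · simp [h1, a1]
  · rw [show ((2 : ℕ) : ℝ) * (3 * π / 4) = 2 * π - ((2 : ℕ) : ℝ) * (π / 4) by push_cast; ring,
      Real.cos_two_pi_sub]
    simp
  · rw [show ((3 : ℕ) : ℝ) * (3 * π / 4) = π / 4 + 2 * π by push_cast; ring,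
      show ((3 : ℕ) : ℝ) * (π / 4) = 3 * π / 4 by push_cast; ring, Real.cos_add_two_pi, h1, a1]
    norm_num
    ring
  · rw [show ((4 : ℕ) : ℝ) * (3 * π / 4) = ((4 : ℕ) : ℝ) * (π / 4) + 2 * π by push_cast; ring,
      Real.cos_add_two_pi]
    simp
  · rw [show ((5 : ℕ) : ℝ) * (3 * π / 4) = 2 * π - π / 4 + 2 * π by push_cast; ring,
      show ((5 : ℕ) : ℝ) * (π / 4) = 2 * π - 3 * π / 4 by push_cast; ring, Real.cos_add_two_pi,
      Real.cos_two_pi_sub, Real.cos_two_pi_sub, h1, a1]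
    norm_num
    ring
  · rw [show ((6 : ℕ) : ℝ) * (3 * π / 4) = 2 * π - ((6 : ℕ) : ℝ) * (π / 4) + 2 * π + 2 * π by
      push_cast; ring, Real.cos_add_two_pi, Real.cos_add_two_pi, Real.cos_two_pi_sub]
    simp
  · rw [show ((7 : ℕ) : ℝ) * (3 * π / 4) = 2 * π - 3 * π / 4 + 2 * π + 2 * π by push_cast; ring,
      show ((7 : ℕ) : ℝ) * (π / 4) = 2 * π - π / 4 by push_cast; ring, Real.cos_add_two_pi,
      Real.cos_add_two_pi,
      Real.cos_two_pi_sub, Real.cos_two_pi_sub, h1, a1]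
    norm_num

lemma L8_val : ∑' n, chf ZMod.χ₈ n = π ^ 2 * √2 / 16 := by
  have h := ((cos_sum (x := 1 / 8) (by norm_num)).sub (cos_sum (x := 3 / 8) (by norm_num))).div_const √2
  have h2 : √2 ^ 2 = (2 : ℝ) := Real.sq_sqrt (by norm_num)
  have h0 : √2 ≠ (0 : ℝ) := by positivity
  rw [← show (π ^ 2 * ((1 / 8:ℝ) ^ 2 - 1 / 8 + 1 / 6) - π ^ 2 * ((3 / 8:ℝ) ^ 2 - 3 / 8 + 1 / 6)) / √2
    = π ^ 2 * √2 / 16 by field_simp; rw [h2]; ring, ← h.tsum_eq]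
  congr 1; ext n
  rw [← mul_sub, show 2 * π * n * (1 / 8) = n * (π / 4) by ring,
    show 2 * π * n * (3 / 8) = n * (3 * π / 4) by ring, cos_diff, chf_apply]
  field_simp

lemma L4_val : ∑' n, chf ZMod.χ₄ n = catalan' := by
  have hs : Summable (chf ZMod.χ₄) := (chf_summable _ c4).of_norm
  rw [← tsum_even_add_odd (hs.comp_injective (i := fun k : ℕ => 2 * k) (fun a b h => by simpa using h))
    (hs.comp_injective (i := fun k : ℕ => 2 * k + 1) (fun a b h => by simpa using h))]
  have h0 : ∀ k : ℕ, chf ZMod.χ₄ (2 * k) = 0 := fun k => by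
    rw [chf_apply, ZMod.χ₄_nat_eq_if_mod_four]; simp
  simp only [h0, tsum_zero, zero_add, catalan']
  congr 1; ext k
  rw [chf_apply, ZMod.χ₄_eq_neg_one_pow (by omega), show (2 * k + 1) / 2 = k by omega]
  push_cast; rfl

lemma catalan_ne : catalan' ≠ 0 := by
  have h4 := (chf_summable _ c4).of_norm
  have h0 := (chf_summable _ c0).of_norm
  have := (h4.add h0).le_tsum 1 (fun n _ => by
    rw [chf_apply, chf_apply, chiZero_nat, ZMod.χ₄_nat_eq_if_mod_four, ← add_div]
    apply div_nonneg _ (by positivity)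
    split_ifs <;> norm_num)
  rw [h4.tsum_add h0, L0_val, L4_val, map_one, map_one] at this
  have := Real.pi_lt_d2
  have := Real.pi_pos
  intro h
  nlinarith

lemma hurwitz_val :
    (1 / 64) * (hurwitzZeta ((1 / 8 : ℝ) : UnitAddCircle) 2
        + hurwitzZeta ((3 / 8 : ℝ) : UnitAddCircle) 2
        - hurwitzZeta ((5 / 8 : ℝ) : UnitAddCircle) 2
        - hurwitzZeta ((7 / 8 : ℝ) : UnitAddCircle) 2) = ((∑' n, chf ZMod.χ₈' n : ℝ) : ℂ) := by
  have h := ZMod.LFunction_eq_LSeries (N := 8) (fun a => ((ZMod.χ₈' a : ℤ) : ℂ)) (s := 2) (by norm_num)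
  have hR : LSeries (fun n : ℕ => ((ZMod.χ₈' (n : ZMod 8) : ℤ) : ℂ)) 2 =
      ((∑' n, chf ZMod.χ₈' n : ℝ) : ℂ) := by
    rw [Complex.ofReal_tsum, LSeries]
    congr 1; ext n
    rw [LSeries.term_def, chf_apply]
    split_ifs with hn
    · simp [hn]
    · push_cast
      norm_cast
  rw [← hR]
  refine Eq.trans ?_ h
  rw [ZMod.LFunction]
  simp only [ZMod.toAddCircle_apply]
  rw [show (Finset.univ : Finset (ZMod 8)) = {0, 1, 2, 3, 4, 5, 6, 7} by decide]
  have v0 : ZMod.χ₈' 0 = 0 := by decide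
  have v1 : ZMod.χ₈' 1 = 1 := by decide
  have v2 : ZMod.χ₈' 2 = 0 := by decide
  have v3 : ZMod.χ₈' 3 = 1 := by decide
  have v4 : ZMod.χ₈' 4 = 0 := by decide
  have v5 : ZMod.χ₈' 5 = -1 := by decide
  have v6 : ZMod.χ₈' 6 = 0 := by decide
  have v7 : ZMod.χ₈' 7 = -1 := by decide
  have w1 : (1 : ZMod 8).val = 1 := rfl
  have w3 : (3 : ZMod 8).val = 3 := rfl
  have w5 : (5 : ZMod 8).val = 5 := rfl
  have w7 : (7 : ZMod 8).val = 7 := rfl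
  have e : ((8 : ℕ) : ℂ) ^ (-2 : ℂ) = 1 / 64 := by
    rw [Complex.cpow_neg, show (2 : ℂ) = ((2 : ℕ) : ℂ) by norm_num, Complex.cpow_natCast]
    norm_num
  rw [e]
  congr 1
  repeat rw [Finset.sum_insert (by decide)]
  rw [Finset.sum_singleton, v0, v1, v2, v3, v4, v5, v6, v7, w1, w3, w5, w7]
  push_cast
  ring

lemma prod_cast : ∏' p : {p : ℕ // p.Prime ∧ p % 8 = 7},
    (((p.1 : ℂ) ^ 2 - 1) / ((p.1 : ℂ) ^ 2 + 1)) ^ 2 = ((∏' p : Nat.Primes, tt p : ℝ) : ℂ) := by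
  have h := (tt_mult.hasProd.map Complex.ofRealHom Complex.continuous_ofReal).tprod_eq
  rw [show ((∏' p : Nat.Primes, tt p : ℝ) : ℂ) = Complex.ofRealHom (∏' p : Nat.Primes, tt p) from rfl,
    ← h]
  let i : {p : ℕ // p.Prime ∧ p % 8 = 7} → Nat.Primes := fun p => ⟨p.1, p.2.1⟩
  have hi : Function.Injective i := fun a b hab => Subtype.ext (congrArg (fun q : Nat.Primes => (q : ℕ)) hab)
  rw [← hi.tprod_eq]
  · congr 1; ext p
    have h7 : ((i p : Nat.Primes) : ℕ) % 8 = 7 := p.2.2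
    simp only [Function.comp, tt, if_pos h7]
    simp [i]
  · intro p hp
    by_cases h7 : (p : ℕ) % 8 = 7
    · exact ⟨⟨p.1, p.2, h7⟩, rfl⟩
    · simp [tt, h7] at hp

theorem stmt14 :
    (1 / 64) * (hurwitzZeta ((1 / 8 : ℝ) : UnitAddCircle) 2
        + hurwitzZeta ((3 / 8 : ℝ) : UnitAddCircle) 2
        - hurwitzZeta ((5 / 8 : ℝ) : UnitAddCircle) 2
        - hurwitzZeta ((7 / 8 : ℝ) : UnitAddCircle) 2) =
      (45 / 32) * (riemannZeta 4 / ((Real.sqrt 2 * catalan' : ℝ) : ℂ)) *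
        ∏' p : {p : ℕ // p.Prime ∧ p % 8 = 7},
          (((p.1 : ℂ) ^ 2 - 1) / ((p.1 : ℂ) ^ 2 + 1)) ^ 2 := by
  rw [hurwitz_val, prod_cast, riemannZeta_four]
  have hm := main_prod
  rw [L4_val, L0_val, L8_val] at hm
  have hc := catalan_ne
  have h2 : √2 ^ 2 = (2 : ℝ) := Real.sq_sqrt (by norm_num)
  have h0 : √2 ≠ (0 : ℝ) := by positivity
  have key : (∑' n, chf ZMod.χ₈' n) = (45 / 32) * ((π ^ 4 / 90) / (√2 * catalan')) *
      ∏' p : Nat.Primes, tt p := by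
    rw [eq_div_of_mul_eq hc hm]
    field_simp
    rw [h2]
    ring
  rw [key]
  push_cast
  rfl
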